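/- Let 0 < r < 1 and set z₀ = i√(1-r²), ρ = (1-√(1-r²))/r, m(ζ) = (ζ - z₀)/(ζ + z₀). The functions e_n(ζ) = ((1-r²)^{1/4}/√π) · m(ζ)ⁿ/(ζ + z₀), n ≥ 1, form an orthonormal system in H²(ℍ₊) (with L²(ℝ) inner product on boundary values), and each is an eigenfunction of the operator Ku(ζ) = (1/2π)∫_Γ i u(τ)/(ζ - τ̄) |dτ| with Γ = C(i, r) (the circle of center i and radius r), with eigenvalue λ_n = r ρ^{2n}/(1 + √(1-r²)). -/

import Mathlib

/-- `z₀ = i√(1-r²)`. -/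
noncomputable def z0UHP (r : ℝ) : ℂ := Complex.I * (Real.sqrt (1 - r ^ 2) : ℂ)

/-- The Möbius map `m(ζ) = (ζ - z₀)/(ζ + z₀)` taking `ℍ₊` to the unit disc. -/
noncomputable def mUHP (r : ℝ) (ζ : ℂ) : ℂ := (ζ - z0UHP r) / (ζ + z0UHP r)

/-- `e_n(ζ) = ((1-r²)^{1/4}/√π) · m(ζ)ⁿ/(ζ + z₀)`. -/
noncomputable def eUHP (r : ℝ) (n : ℕ) (ζ : ℂ) : ℂ :=
  (((1 - r ^ 2) ^ ((1 : ℝ) / 4) / Real.sqrt Real.pi : ℝ) : ℂ) *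
    mUHP r ζ ^ n / (ζ + z0UHP r)

/-- `λ_n = r ρ^{2n}/(1 + √(1-r²))` with `ρ = (1-√(1-r²))/r`. -/
noncomputable def lamUHP (r : ℝ) (n : ℕ) : ℝ :=
  r * ((1 - Real.sqrt (1 - r ^ 2)) / r) ^ (2 * n) / (1 + Real.sqrt (1 - r ^ 2))

theorem z0UHP_sq {r : ℝ} (hr1 : r ^ 2 < 1) : z0UHP r ^ 2 = (r : ℂ) ^ 2 - 1 := by
  have h : ((Real.sqrt (1 - r ^ 2) : ℝ) : ℂ) ^ 2 = 1 - (r : ℂ) ^ 2 := by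
    exact_mod_cast congrArg ((↑) : ℝ → ℂ) (Real.sq_sqrt (by linarith : 0 ≤ 1 - r ^ 2))
  rw [z0UHP, mul_pow, h, Complex.I_sq]
  ring

theorem add_z0UHP_ne_zero {r : ℝ} {ζ : ℂ} (h : 0 < ζ.im) : ζ + z0UHP r ≠ 0 := by
  intro h0
  have := congrArg Complex.im h0
  simp [z0UHP] at this
  linarith [Real.sqrt_nonneg (1 - r ^ 2)]

theorem ofReal_add_z0UHP_ne_zero {r : ℝ} (hr1 : r ^ 2 < 1) (x : ℝ) :
    (x : ℂ) + z0UHP r ≠ 0 := by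
  intro h0
  have := congrArg Complex.im h0
  simp [z0UHP] at this
  linarith [Real.sqrt_pos.2 (by linarith : 0 < 1 - r ^ 2)]

theorem ofReal_sub_z0UHP_ne_zero {r : ℝ} (hr1 : r ^ 2 < 1) (x : ℝ) :
    (x : ℂ) - z0UHP r ≠ 0 := by
  intro h0
  have := congrArg Complex.im h0
  simp [z0UHP] at this
  linarith [Real.sqrt_pos.2 (by linarith : 0 < 1 - r ^ 2)]

theorem z0UHP_ne_zero {r : ℝ} (hr1 : r ^ 2 < 1) : z0UHP r ≠ 0 := by
  simpa using ofReal_add_z0UHP_ne_zero hr1 0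

theorem conj_z0UHP (r : ℝ) : (starRingEnd ℂ) (z0UHP r) = -z0UHP r := by
  simp [z0UHP]

theorem mUHP_ofReal_ne_zero {r : ℝ} (hr1 : r ^ 2 < 1) (x : ℝ) : mUHP r x ≠ 0 :=
  div_ne_zero (ofReal_sub_z0UHP_ne_zero hr1 x) (ofReal_add_z0UHP_ne_zero hr1 x)

theorem conj_mUHP_ofReal (r : ℝ) (x : ℝ) : (starRingEnd ℂ) (mUHP r x) = (mUHP r x)⁻¹ := by
  simp [mUHP, conj_z0UHP, ← sub_eq_add_neg]

theorem norm_mUHP_ofReal {r : ℝ} (hr1 : r ^ 2 < 1) (x : ℝ) : ‖mUHP r x‖ = 1 := by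
  have h : ((‖mUHP r x‖ ^ 2 : ℝ) : ℂ) = 1 := by
    rw [Complex.ofReal_pow, ← Complex.mul_conj', conj_mUHP_ofReal,
      mul_inv_cancel₀ (mUHP_ofReal_ne_zero hr1 x)]
  have h' : ‖mUHP r x‖ ^ 2 = 1 := by exact_mod_cast h
  exact (pow_eq_one_iff_of_nonneg (norm_nonneg _) two_ne_zero).1 h'

theorem sub_z0UHP_mul_add_z0UHP {r : ℝ} (hr1 : r ^ 2 < 1) (x : ℝ) :
    ((x : ℂ) - z0UHP r) * ((x : ℂ) + z0UHP r) =
      ((x ^ 2 + Real.sqrt (1 - r ^ 2) ^ 2 : ℝ) : ℂ) := by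
  rw [Real.sq_sqrt (by linarith)]
  push_cast
  linear_combination -z0UHP_sq hr1

theorem sq_eUHP_coeff {r : ℝ} (hr1 : r ^ 2 < 1) :
    ((1 - r ^ 2) ^ ((1 : ℝ) / 4) / Real.sqrt Real.pi) ^ 2 =
      Real.sqrt (1 - r ^ 2) / Real.pi := by
  rw [div_pow, Real.sq_sqrt Real.pi_pos.le, ← Real.rpow_natCast, ← Real.rpow_mul (by linarith),
    Real.sqrt_eq_rpow]
  norm_num

theorem conj_eUHP_mul_eUHP {r : ℝ} (hr1 : r ^ 2 < 1) (n k : ℕ) (x : ℝ) :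
    (starRingEnd ℂ) (eUHP r n x) * eUHP r k x =
      ((Real.sqrt (1 - r ^ 2) / Real.pi : ℝ) : ℂ) *
        (mUHP r x ^ ((k : ℤ) - n) *
          (((x ^ 2 + Real.sqrt (1 - r ^ 2) ^ 2)⁻¹ : ℝ) : ℂ)) := by
  rw [zpow_sub₀ (mUHP_ofReal_ne_zero hr1 x), ← sq_eUHP_coeff hr1, Complex.ofReal_inv,
    ← sub_z0UHP_mul_add_z0UHP hr1]
  simp only [eUHP, map_div₀, map_mul, map_pow, map_add, Complex.conj_ofReal, conj_z0UHP,
    conj_mUHP_ofReal, zpow_natCast, Complex.ofReal_pow, inv_pow, ← sub_eq_add_neg, mul_inv]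
  ring

theorem integrable_inv_sq_add_sq {s : ℝ} (hs : s ≠ 0) :
    MeasureTheory.Integrable fun x : ℝ => (x ^ 2 + s ^ 2)⁻¹ := by
  have h := (integrable_inv_one_add_sq.comp_div hs).const_mul (s ^ 2)⁻¹
  refine h.congr (Filter.Eventually.of_forall fun x => ?_)
  simp only
  rw [← mul_inv]
  congr 1
  field_simp
  ring

theorem integral_univ_inv_sq_add_sq {s : ℝ} (hs : 0 < s) :
    ∫ x : ℝ, (x ^ 2 + s ^ 2)⁻¹ = Real.pi / s := by
  have h := MeasureTheory.Measure.integral_comp_div (fun x : ℝ => (1 + x ^ 2)⁻¹) s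
  rw [integral_univ_inv_one_add_sq, abs_of_pos hs, smul_eq_mul] at h
  have h2 : (fun x : ℝ => (x ^ 2 + s ^ 2)⁻¹) =
      fun x : ℝ => (s ^ 2)⁻¹ * (1 + (x / s) ^ 2)⁻¹ := by
    funext x
    rw [← mul_inv]
    congr 1
    field_simp
    ring
  rw [h2, MeasureTheory.integral_const_mul, h]
  field_simp

theorem hasDerivAt_mUHP_zpow {r : ℝ} (hr1 : r ^ 2 < 1) (j : ℤ) (x : ℝ) :
    HasDerivAt (fun y : ℝ => mUHP r y ^ j)
      (j * (2 * z0UHP r) * (mUHP r x ^ j *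
        (((x ^ 2 + Real.sqrt (1 - r ^ 2) ^ 2)⁻¹ : ℝ) : ℂ))) x := by
  have hp := ofReal_add_z0UHP_ne_zero hr1 x
  have hm := ofReal_sub_z0UHP_ne_zero hr1 x
  have h1 : HasDerivAt (mUHP r) (2 * z0UHP r / ((x : ℂ) + z0UHP r) ^ 2) (x : ℂ) := by
    refine (((hasDerivAt_id (x : ℂ)).sub_const (z0UHP r)).div
      ((hasDerivAt_id (x : ℂ)).add_const (z0UHP r)) hp).congr_deriv ?_
    simp only [id]
    ring
  have h2 := ((hasDerivAt_zpow j (mUHP r x) (Or.inl (mUHP_ofReal_ne_zero hr1 x))).comp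
    (x : ℂ) h1).comp_ofReal
  refine h2.congr_deriv ?_
  rw [zpow_sub_one₀ (mUHP_ofReal_ne_zero hr1 x), Complex.ofReal_inv,
    ← sub_z0UHP_mul_add_z0UHP hr1]
  generalize mUHP r x ^ j = M
  rw [mUHP]
  field_simp

theorem tendsto_mUHP_zpow (r : ℝ) (j : ℤ) {l : Filter ℝ}
    (hl : Filter.Tendsto (fun x : ℝ => (x : ℂ)) l (Bornology.cobounded ℂ)) :
    Filter.Tendsto (fun x : ℝ => mUHP r x ^ j) l (nhds 1) := by
  have h0 : Filter.Tendsto (fun x : ℝ => (x : ℂ)⁻¹) l (nhds 0) :=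
    Filter.tendsto_inv₀_cobounded.comp hl
  have hne : ∀ᶠ x : ℝ in l, (x : ℂ) ≠ 0 := hl.eventually (Bornology.eventually_ne_cobounded 0)
  have h1 : Filter.Tendsto (fun x : ℝ => mUHP r x) l (nhds 1) := by
    have h := ((tendsto_const_nhds (x := (1 : ℂ))).sub (h0.const_mul (z0UHP r))).div
      ((tendsto_const_nhds (x := (1 : ℂ))).add (h0.const_mul (z0UHP r))) (by simp)
    simp only [mul_zero, sub_zero, add_zero, div_one] at h
    refine h.congr' ?_
    filter_upwards [hne] with x hx
    rw [Pi.div_apply, mUHP, ← mul_div_mul_left _ _ hx]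
    field_simp
  simpa using h1.zpow₀ j (Or.inl one_ne_zero)

theorem integrable_mUHP_zpow_mul {r : ℝ} (hr1 : r ^ 2 < 1) (j : ℤ) :
    MeasureTheory.Integrable fun x : ℝ => mUHP r x ^ j *
      (((x ^ 2 + Real.sqrt (1 - r ^ 2) ^ 2)⁻¹ : ℝ) : ℂ) := by
  have hs : 0 < Real.sqrt (1 - r ^ 2) := Real.sqrt_pos.2 (by linarith)
  refine (integrable_inv_sq_add_sq hs.ne').ofReal.bdd_mul (c := 1) ?_ ?_
  · exact (continuous_iff_continuousAt.2 fun x =>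
      (hasDerivAt_mUHP_zpow hr1 j x).continuousAt).aestronglyMeasurable
  · exact Filter.Eventually.of_forall fun x => by
      rw [norm_zpow, norm_mUHP_ofReal hr1, one_zpow]

theorem integral_mUHP_zpow_mul {r : ℝ} (hr1 : r ^ 2 < 1) {j : ℤ} (hj : j ≠ 0) :
    ∫ x : ℝ, mUHP r x ^ j * (((x ^ 2 + Real.sqrt (1 - r ^ 2) ^ 2)⁻¹ : ℝ) : ℂ) = 0 := by
  have hc : (j : ℂ) * (2 * z0UHP r) ≠ 0 :=
    mul_ne_zero (Int.cast_ne_zero.2 hj) (mul_ne_zero two_ne_zero (z0UHP_ne_zero hr1))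
  have h := MeasureTheory.integral_of_hasDerivAt_of_tendsto (hasDerivAt_mUHP_zpow hr1 j)
    ((integrable_mUHP_zpow_mul hr1 j).const_mul _)
    (tendsto_mUHP_zpow r j (RCLike.tendsto_ofReal_atBot_cobounded ℂ))
    (tendsto_mUHP_zpow r j (RCLike.tendsto_ofReal_atTop_cobounded ℂ))
  rw [MeasureTheory.integral_const_mul, sub_self] at h
  exact (mul_eq_zero.1 h).resolve_left hc

theorem integral_conj_eUHP_mul_eUHP {r : ℝ} (hr1 : r ^ 2 < 1) (n k : ℕ) :
    ∫ x : ℝ, (starRingEnd ℂ) (eUHP r n x) * eUHP r k x = if n = k then 1 else 0 := by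
  have hs : 0 < Real.sqrt (1 - r ^ 2) := Real.sqrt_pos.2 (by linarith)
  simp only [conj_eUHP_mul_eUHP hr1]
  rw [MeasureTheory.integral_const_mul]
  split_ifs with h
  · subst h
    simp only [sub_self, zpow_zero, one_mul]
    rw [integral_complex_ofReal, integral_univ_inv_sq_add_sq hs, ← Complex.ofReal_mul]
    norm_cast
    field_simp [Real.pi_ne_zero]
  · rw [integral_mUHP_zpow_mul hr1 (by omega), mul_zero]

theorem one_lt_norm_add_I {ζ : ℂ} (h : 0 < ζ.im) : 1 < ‖ζ + Complex.I‖ := by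
  have := (le_abs_self _).trans (Complex.abs_im_le_norm (ζ + Complex.I))
  simp at this
  linarith

theorem add_I_ne_zero {ζ : ℂ} (h : 0 < ζ.im) : ζ + Complex.I ≠ 0 :=
  norm_pos_iff.1 (one_pos.trans (one_lt_norm_add_I h))

/-- On `C(i,r)` one has `τ̄ = -i + r²/(τ - i)`, so Cauchy's integral formula evaluates the
integral operator with kernel `i/(ζ - τ̄)` at the reflection of `ζ`. -/
theorem integral_circle_kernel {r : ℝ} (hr : 0 < r) (hr1 : r < 1) {u : ℂ → ℂ}
    (hu : DifferentiableOn ℂ u (Metric.closedBall Complex.I r)) {ζ : ℂ} (hζ : 0 < ζ.im) :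
    ∫ t in (0:ℝ)..(2 * Real.pi),
        Complex.I * u (Complex.I + (r : ℂ) * Complex.exp (Complex.I * (t : ℂ))) /
          (ζ - (starRingEnd ℂ) (Complex.I + (r : ℂ) * Complex.exp (Complex.I * (t : ℂ)))) *
        (r : ℂ) =
      2 * Real.pi * (Complex.I * r / (ζ + Complex.I)) *
        u (Complex.I + (r : ℂ) ^ 2 / (ζ + Complex.I)) := by
  have hI := add_I_ne_zero hζ
  have hn := one_lt_norm_add_I hζ
  have hr0 : (r : ℂ) ≠ 0 := Complex.ofReal_ne_zero.2 hr.ne'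
  have hw : Complex.I + (r : ℂ) ^ 2 / (ζ + Complex.I) ∈ Metric.ball Complex.I r := by
    rw [mem_ball_iff_norm, add_sub_cancel_left, norm_div, norm_pow, Complex.norm_real,
      Real.norm_of_nonneg hr.le, div_lt_iff₀ (one_pos.trans hn)]
    nlinarith
  have hC := (hu.diffContOnCl_ball subset_rfl).circleIntegral_sub_inv_smul hw
  have hC' : (r / (ζ + Complex.I)) * (∮ z in C(Complex.I, r),
      (z - (Complex.I + (r : ℂ) ^ 2 / (ζ + Complex.I)))⁻¹ • u z) =
      2 * Real.pi * (Complex.I * r / (ζ + Complex.I)) *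
        u (Complex.I + (r : ℂ) ^ 2 / (ζ + Complex.I)) := by
    rw [hC, smul_eq_mul]
    ring
  rw [← hC', circleIntegral, ← intervalIntegral.integral_const_mul]
  refine intervalIntegral.integral_congr fun t _ => ?_
  simp only [deriv_circleMap, circleMap, smul_eq_mul, zero_add, mul_comm (t : ℂ) Complex.I,
    map_add, map_mul, Complex.conj_I, Complex.conj_ofReal, ← Complex.exp_conj]
  rw [neg_mul, Complex.exp_neg]
  have hE : ‖Complex.exp (Complex.I * t)‖ = 1 := by
    rw [mul_comm, Complex.norm_exp_ofReal_mul_I]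
  have hE0 := Complex.exp_ne_zero (Complex.I * t)
  generalize Complex.exp (Complex.I * t) = E at *
  have hD : (ζ + Complex.I) * E - r ≠ 0 := by
    intro h
    have := congrArg norm (sub_eq_zero.1 h)
    rw [norm_mul, hE, mul_one, Complex.norm_real, Real.norm_of_nonneg hr.le] at this
    linarith
  have h1 : ζ - (-Complex.I + r * E⁻¹) = ((ζ + Complex.I) * E - r) / E := by
    field_simp
    ring
  have h2 : Complex.I + r * E - (Complex.I + (r : ℂ) ^ 2 / (ζ + Complex.I)) =
      r * ((ζ + Complex.I) * E - r) / (ζ + Complex.I) := by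
    field_simp
    ring
  rw [h1, h2]
  generalize u (Complex.I + r * E) = U
  generalize (ζ + Complex.I) * E - r = D at *
  field_simp

theorem differentiableOn_eUHP {r : ℝ} (hr1 : r < 1) (n : ℕ) :
    DifferentiableOn ℂ (eUHP r n) (Metric.closedBall Complex.I r) := by
  intro τ hτ
  have him : 0 < τ.im := by
    have h := (Complex.abs_im_le_norm (τ - Complex.I)).trans (mem_closedBall_iff_norm.1 hτ)
    rw [Complex.sub_im, Complex.I_im] at h
    linarith [neg_abs_le (τ.im - 1)]
  have hne := add_z0UHP_ne_zero (r := r) him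
  refine DifferentiableAt.differentiableWithinAt ?_
  unfold eUHP mUHP
  fun_prop (disch := assumption)

theorem eUHP_reflection {r : ℝ} (hr : 0 < r) (hr1 : r < 1) (n : ℕ) {ζ : ℂ} (hζ : 0 < ζ.im) :
    Complex.I * r / (ζ + Complex.I) * eUHP r n (Complex.I + (r : ℂ) ^ 2 / (ζ + Complex.I)) =
      (lamUHP r n : ℂ) * eUHP r n ζ := by
  have hsq : Real.sqrt (1 - r ^ 2) ^ 2 = 1 - r ^ 2 := Real.sq_sqrt (by nlinarith)
  have hs := Real.sqrt_nonneg (1 - r ^ 2)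
  have hI := add_I_ne_zero hζ
  have hz := add_z0UHP_ne_zero (r := r) hζ
  unfold eUHP lamUHP mUHP
  unfold z0UHP at *
  generalize Real.sqrt (1 - r ^ 2) = s at *
  have hsC : (r : ℂ) ^ 2 = 1 - (s : ℂ) ^ 2 := by
    have : r ^ 2 = 1 - s ^ 2 := by linarith
    exact_mod_cast congrArg ((↑) : ℝ → ℂ) this
  have h1s : (1 + s : ℂ) ≠ 0 := by exact_mod_cast (by linarith : 1 + s ≠ 0)
  have hρ : ((1 - s) / r) ^ 2 = (1 - s) / (1 + s) := by
    have : 1 + s ≠ 0 := by linarith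
    field_simp
    nlinarith
  have hp : Complex.I + (r : ℂ) ^ 2 / (ζ + Complex.I) + Complex.I * s =
      Complex.I * (1 + s) * (ζ + Complex.I * s) / (ζ + Complex.I) := by
    rw [hsC]
    field_simp
    linear_combination (1 - (s : ℂ) ^ 2) * Complex.I_sq
  have hm : Complex.I + (r : ℂ) ^ 2 / (ζ + Complex.I) - Complex.I * s =
      Complex.I * (1 - s) * (ζ - Complex.I * s) / (ζ + Complex.I) := by
    rw [hsC]
    field_simp
    linear_combination (1 - (s : ℂ) ^ 2) * Complex.I_sq
  have hq : Complex.I * (1 - s) * (ζ - Complex.I * s) / (ζ + Complex.I) /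
      (Complex.I * (1 + s) * (ζ + Complex.I * s) / (ζ + Complex.I)) =
      (1 - s) / (1 + s) * ((ζ - Complex.I * s) / (ζ + Complex.I * s)) := by
    field_simp
  rw [pow_mul, hρ, hp, hm, hq, mul_pow]
  push_cast
  generalize ((ζ - Complex.I * s) / (ζ + Complex.I * s)) ^ n = M
  generalize ((1 - s : ℂ) / (1 + s)) ^ n = R
  field_simp

/-- the functions `e_n`, `n ≥ 1`, form an orthonormal system in
`H²(ℍ₊)` (inner product of boundary values in `L²(ℝ)`), and each is an
eigenfunction, with eigenvalue `λ_n`, of the operator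
`Ku(ζ) = (1/2π) ∫_Γ i u(τ)/(ζ - τ̄) |dτ|`, where `Γ = C(i,r)`. -/
theorem stmt14 (r : ℝ) (hr : 0 < r) (hr1 : r < 1) :
    (∀ n m : ℕ, 1 ≤ n → 1 ≤ m →
      (∫ x : ℝ, (starRingEnd ℂ) (eUHP r n (x : ℂ)) * eUHP r m (x : ℂ))
        = if n = m then 1 else 0) ∧
    (∀ n : ℕ, 1 ≤ n → ∀ ζ : ℂ, 0 < ζ.im →
      (1 / (2 * Real.pi) : ℂ) * ∫ t in (0:ℝ)..(2 * Real.pi),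
          Complex.I * eUHP r n (Complex.I + (r : ℂ) * Complex.exp (Complex.I * (t : ℂ))) /
            (ζ - (starRingEnd ℂ) (Complex.I + (r : ℂ) * Complex.exp (Complex.I * (t : ℂ)))) *
          (r : ℂ)
        = (lamUHP r n : ℂ) * eUHP r n ζ) := by
  refine ⟨fun n k _ _ => integral_conj_eUHP_mul_eUHP (by nlinarith) n k, fun n _ ζ hζ => ?_⟩
  rw [integral_circle_kernel hr hr1 (differentiableOn_eUHP hr1 n) hζ, mul_assoc,
    eUHP_reflection hr hr1 n hζ, ← mul_assoc, one_div, inv_mul_cancel₀, one_mul]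
  exact mul_ne_zero two_ne_zero (Complex.ofReal_ne_zero.2 Real.pi_ne_zero)
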